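/- Let q, x, y₁, y₂, z be complex numbers with |q| < 1 and |x|, |y₁|, |y₂|, |z| ≤ 1. Then Σ_{λ ∈ 𝒜} x^{♯(λ)} y₁^{♯_{2,4}(λ)} y₂^{♯_{0,4}(λ)} z^{𝖮(λ)} q^{|λ|} = Σ_{n₁,n₂,n₃,n₄ ≥ 0} x^{n₁+n₂+n₃+n₄} y₁^{n₃} y₂^{n₄} z^{n₂} q^{Q(n₁,n₂,n₃,n₄) + n₁ + n₂ + 2n₃ + 4n₄} / ((q²;q²)_{n₁}(q²;q²)_{n₂}(q⁴;q⁴)_{n₃}(q⁴;q⁴)_{n₄}), where both series converge absolutely. -/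

import Mathlib

/-- The finite q-Pochhammer symbol `(a; q)_n = ∏_{k=0}^{n-1} (1 - a q^k)`. -/
noncomputable def qPoch (a q : ℂ) (n : ℕ) : ℂ :=
  ∏ k ∈ Finset.range n, (1 - a * q ^ k)

/-- The quadratic form `Q(n₁,n₂,n₃,n₄)`. -/
def Qform (n₁ n₂ n₃ n₄ : ℕ) : ℕ :=
  4 * Nat.choose n₁ 2 + 6 * Nat.choose n₂ 2 + 4 * Nat.choose n₃ 2 + 8 * Nat.choose n₄ 2 +
    4 * (n₁ * n₂ + n₁ * n₃ + n₁ * n₄ + n₂ * n₃ + n₂ * n₄ + n₃ * n₄)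

/-- Membership in the set `𝒜`: an overpartition is a pair `(P, O)` with `P` a finite set of
positive integers (the parts) and `O ⊆ {p ∈ P : p odd}` (the overlined parts), such that any
two parts `a > b` differ by at least 4, and by at least 5 whenever `a` is overlined or
divisible by 4. -/
def MemA (P O : Finset ℕ) : Prop :=
  (∀ p ∈ P, 0 < p) ∧ O ⊆ P ∧ (∀ p ∈ O, Odd p) ∧
    ∀ a ∈ P, ∀ b ∈ P, b < a →
      4 ≤ a - b ∧ ((a ∈ O ∨ 4 ∣ a) → 5 ≤ a - b)

/-- `♯_{a,M}(λ)`: the number of parts of `λ` congruent to `a` modulo `M`. -/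
def countMod (a M : ℕ) (P : Finset ℕ) : ℕ := (P.filter fun p => p % M = a).card

section

open Filter Topology Set

theorem eq_zero_of_recurrence {D c : ℕ → ℂ} {u : ℕ → ℕ} (hD : Tendsto D atTop (𝓝 0))
    (hc : Summable fun s => ‖c s‖) (hu : ∀ s, s < u s)
    (h : ∀ s, D s = D (s + 1) + c s * D (u s)) (s : ℕ) : D s = 0 := by
  obtain ⟨K, hK⟩ : ∃ K, ∑' i, ‖c (i + K)‖ ≤ 1 / 2 :=
    ((tendsto_order.1 (tendsto_sum_nat_add fun s => ‖c s‖)).2 _ one_half_pos).exists.imp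
      fun _ => le_of_lt
  obtain ⟨B, hB⟩ := (Metric.isBounded_range_of_tendsto D hD).exists_norm_le
  replace hB : ∀ s, ‖D s‖ ≤ B := fun s => hB _ ⟨s, rfl⟩
  have hB0 : 0 ≤ B := (norm_nonneg _).trans (hB 0)
  have hsum (s : ℕ) (hs : K ≤ s) (j : ℕ) : ∑ i ∈ Finset.range j, ‖c (s + i)‖ ≤ 1 / 2 := by
    obtain ⟨d, rfl⟩ := Nat.exists_eq_add_of_le hs
    refine le_trans ?_ hK
    have hs' := (summable_nat_add_iff K).2 hc
    refine le_trans (le_of_eq ?_) (hs'.sum_le_tsum ((Finset.range j).map (addLeftEmbedding d))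
      fun _ _ => norm_nonneg _)
    simp [Finset.sum_map, add_comm, add_left_comm]
  have hexp (s j : ℕ) : D s = D (s + j) + ∑ i ∈ Finset.range j, c (s + i) * D (u (s + i)) := by
    induction j with
    | zero => simp
    | succ j ih => rw [ih, Finset.sum_range_succ, h (s + j)]; ring_nf
  have hbound (n : ℕ) : ∀ s, K ≤ s → ‖D s‖ ≤ B * (1 / 2) ^ n := by
    induction n with
    | zero => simpa using fun s _ => hB s
    | succ n ih =>
      intro s hs
      have hlim : Tendsto (fun j => ‖D (s + j)‖ + B * (1 / 2) ^ (n + 1)) atTop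
          (𝓝 (0 + B * (1 / 2) ^ (n + 1))) := by
        refine Tendsto.add_const _ ?_
        simpa [add_comm] using ((tendsto_add_atTop_iff_nat s).2 hD).norm
      rw [zero_add] at hlim
      refine ge_of_tendsto' hlim fun j => ?_
      rw [hexp s j]
      refine (norm_add_le _ _).trans ((add_le_add_iff_left _).2 ?_)
      calc ‖∑ i ∈ Finset.range j, c (s + i) * D (u (s + i))‖
          ≤ ∑ i ∈ Finset.range j, ‖c (s + i)‖ * (B * (1 / 2) ^ n) := by
            refine norm_sum_le_of_le _ fun i _ => ?_
            rw [norm_mul]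
            have := hu (s + i)
            gcongr
            exact ih _ (by omega)
        _ = (∑ i ∈ Finset.range j, ‖c (s + i)‖) * (B * (1 / 2) ^ n) := (Finset.sum_mul ..).symm
        _ ≤ 1 / 2 * (B * (1 / 2) ^ n) := by gcongr; exact hsum s hs j
        _ = B * (1 / 2) ^ (n + 1) := by ring
  have hlarge (s : ℕ) (hs : K ≤ s) : D s = 0 := by
    have hlim : Tendsto (fun n : ℕ => B * (1 / 2 : ℝ) ^ n) atTop (𝓝 (B * 0)) :=
      (tendsto_pow_atTop_nhds_zero_of_lt_one (by norm_num) (by norm_num)).const_mul B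
    rw [mul_zero] at hlim
    exact norm_le_zero_iff.1 (ge_of_tendsto' hlim fun n => hbound n s hs)
  have hdown (d : ℕ) : ∀ s, K ≤ s + d → D s = 0 := by
    induction d with
    | zero => exact hlarge
    | succ d ih =>
      intro s hs
      have := hu s
      rw [h s, ih (s + 1) (by omega), ih (u s) (by omega), mul_zero, add_zero]
  exact hdown K s (by omega)

theorem tsum_eq_tsum_add_mul_tsum {ι : Type*} {f g h : ι → ℂ} {c : ℂ} (hf : Summable f)
    (hg : Summable g) {U : Set ι} {φ : ι → ι} (hφ : InjOn φ U) (hU : Function.support h ⊆ U)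
    (hfg : ∀ n, n ∉ φ '' U → f n = g n) (hh : ∀ n ∈ U, f (φ n) = g (φ n) + c * h n) :
    ∑' n, f n = ∑' n, g n + c * ∑' n, h n := by
  rw [← sub_eq_iff_eq_add', ← hf.tsum_sub hg, ← tsum_mul_left,
    ← tsum_subtype_eq_of_support_subset (s := φ '' U), tsum_image (fun n => f n - g n) hφ,
    ← tsum_subtype_eq_of_support_subset (s := U)]
  · exact tsum_congr fun n => by simp [hh n n.2]
  · exact fun n hn => hU (right_ne_zero_of_mul hn)
  · intro n hn
    by_contra hn'
    exact hn (sub_eq_zero.2 (hfg n hn'))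

theorem summable_pow_two_thirds {r : ℝ} (h0 : 0 ≤ r) (h1 : r < 1) :
    Summable fun s : ℕ => r ^ (1 + 2 * s / 3) := by
  have hρ : (r ^ ((3 : ℕ)⁻¹ : ℝ)) ^ 3 = r := Real.rpow_inv_natCast_pow h0 (by norm_num)
  have hρ0 : 0 ≤ r ^ ((3 : ℕ)⁻¹ : ℝ) := Real.rpow_nonneg h0 _
  have hρ1 : r ^ ((3 : ℕ)⁻¹ : ℝ) < 1 := Real.rpow_lt_one h0 h1 (by norm_num)
  generalize r ^ ((3 : ℕ)⁻¹ : ℝ) = ρ at hρ hρ0 hρ1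
  refine (summable_geometric_of_lt_one hρ0 hρ1).of_nonneg_of_le (fun s => by positivity)
    fun s => ?_
  rw [← hρ, ← pow_mul]
  exact pow_le_pow_of_le_one hρ0 hρ1.le (by omega)

theorem qPoch_succ (a q : ℂ) (n : ℕ) : qPoch a q (n + 1) = qPoch a q n * (1 - a * q ^ n) :=
  Finset.prod_range_succ ..

theorem one_sub_mul_pow_ne_zero {q : ℂ} (hq : ‖q‖ < 1) (n : ℕ) : 1 - q * q ^ n ≠ 0 := by
  rw [← pow_succ', sub_ne_zero]
  intro h
  have := congrArg norm h
  rw [norm_one, norm_pow] at this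
  exact absurd (pow_lt_one₀ (norm_nonneg q) hq n.succ_ne_zero) (by rw [← this]; exact lt_irrefl _)

theorem qPoch_self_ne_zero {q : ℂ} (hq : ‖q‖ < 1) (n : ℕ) : qPoch q q n ≠ 0 :=
  Finset.prod_ne_zero_iff.2 fun k _ => one_sub_mul_pow_ne_zero hq k

theorem exists_norm_inv_qPoch_le {q : ℂ} (hq : ‖q‖ < 1) :
    ∃ C, 0 ≤ C ∧ ∀ n, ‖(qPoch q q n)⁻¹‖ ≤ C := by
  set r := ‖q‖ with hr
  have hr0 : 0 ≤ r := norm_nonneg q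
  have h1r : 0 < 1 - r := sub_pos.2 hq
  refine ⟨Real.exp (∑' k : ℕ, r ^ k / (1 - r)), (Real.exp_pos _).le, fun n => ?_⟩
  have hterm (k : ℕ) : ‖(1 - q * q ^ k)⁻¹‖ ≤ Real.exp (r ^ k / (1 - r)) := by
    have hk : r * r ^ k ≤ r := mul_le_of_le_one_right hr0 (pow_le_one₀ hr0 hq.le)
    have hk' : r * r ^ k ≤ r ^ k := mul_le_of_le_one_left (by positivity) hq.le
    have hlow : 1 - r * r ^ k ≤ ‖1 - q * q ^ k‖ := by
      simpa [hr] using norm_sub_norm_le (1 : ℂ) (q * q ^ k)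
    have hpos : 0 < 1 - r * r ^ k := by linarith
    rw [norm_inv]
    calc ‖1 - q * q ^ k‖⁻¹ ≤ (1 - r * r ^ k)⁻¹ := inv_anti₀ hpos hlow
      _ = r * r ^ k / (1 - r * r ^ k) + 1 := by field_simp; ring
      _ ≤ r ^ k / (1 - r) + 1 := by gcongr
      _ ≤ _ := Real.add_one_le_exp _
  have hsum : Summable fun k : ℕ => r ^ k / (1 - r) :=
    (summable_geometric_of_lt_one hr0 hq).div_const _
  rw [qPoch, ← Finset.prod_inv_distrib, norm_prod]
  calc ∏ k ∈ Finset.range n, ‖(1 - q * q ^ k)⁻¹‖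
      ≤ ∏ k ∈ Finset.range n, Real.exp (r ^ k / (1 - r)) :=
        Finset.prod_le_prod (fun _ _ => norm_nonneg _) fun k _ => hterm k
    _ = Real.exp (∑ k ∈ Finset.range n, r ^ k / (1 - r)) := (Real.exp_sum ..).symm
    _ ≤ _ := Real.exp_le_exp.2 (hsum.sum_le_tsum _ fun k _ => by positivity)

/-- The `s`-th step of the recurrence passes over parts of size `minPart s`. -/
def minPart (s : ℕ) : ℕ := 1 + 2 * s / 3

/-- Lower bound for the overlined parts after `s` steps of the recurrence. -/
def minOver (s : ℕ) : ℕ := 1 + 2 * ((s + 2) / 3)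

/-- The state reached from state `s` after using a part of size `minPart s`. -/
def jump (s : ℕ) : ℕ := if s % 3 = 1 ∨ s % 6 = 2 then s + 6 else s + 7

/-- The overpartitions in `𝒜` still available after `s` steps of the recurrence. -/
def stateA (s : ℕ) : Set (Finset ℕ × Finset ℕ) :=
  {l | MemA l.1 l.2 ∧ (∀ p ∈ l.1, minPart s ≤ p) ∧ ∀ p ∈ l.2, minOver s ≤ p}

/-- Adds the part `minPart s`, overlined if `3 ∣ s`. -/
def addPart (s : ℕ) (l : Finset ℕ × Finset ℕ) : Finset ℕ × Finset ℕ :=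
  (insert (minPart s) l.1, if s % 3 = 0 then insert (minPart s) l.2 else l.2)

theorem lt_jump (s : ℕ) : s < jump s := by
  unfold jump; split_ifs <;> omega

theorem MemA.subset {P O P' O' : Finset ℕ} (h : MemA P O) (hP : P' ⊆ P) (hO : O' ⊆ O)
    (hOP : O' ⊆ P') : MemA P' O' :=
  ⟨fun p hp => h.1 p (hP hp), hOP, fun p hp => h.2.2.1 p (hO hp), fun a ha b hb hab =>
    ⟨(h.2.2.2 a (hP ha) b (hP hb) hab).1, fun hc =>
      (h.2.2.2 a (hP ha) b (hP hb) hab).2 (hc.imp_left fun h' => hO h')⟩⟩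

theorem memA_insert {P O : Finset ℕ} {k : ℕ} (h : MemA P O) (hk : 0 < k)
    (hP : ∀ p ∈ P, k + 4 ≤ p) (hP' : ∀ p ∈ P, p ∈ O ∨ 4 ∣ p → k + 5 ≤ p) :
    MemA (insert k P) O := by
  refine ⟨fun p hp => ?_, h.2.1.trans (Finset.subset_insert _ _), h.2.2.1,
    fun a ha b hb hab => ?_⟩
  · rcases Finset.mem_insert.1 hp with rfl | hp
    exacts [hk, h.1 p hp]
  · rcases Finset.mem_insert.1 ha with hak | ha' <;>
      rcases Finset.mem_insert.1 hb with hbk | hb'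
    · omega
    · have := hP b hb'; omega
    · have h1 := hP a ha'
      have h2 := hP' a ha'
      exact ⟨by omega, fun hc => by have := h2 hc; omega⟩
    · exact h.2.2.2 a ha' b hb' hab

theorem memA_insert_overlined {P O : Finset ℕ} {k : ℕ} (h : MemA P O) (hk : Odd k)
    (hP : ∀ p ∈ P, k + 4 ≤ p) (hP' : ∀ p ∈ P, p ∈ O ∨ 4 ∣ p → k + 5 ≤ p) :
    MemA (insert k P) (insert k O) := by
  obtain ⟨h1, h2, h3, h4⟩ := memA_insert h hk.pos hP hP'
  refine ⟨h1, Finset.insert_subset_insert _ h.2.1, fun p hp => ?_, fun a ha b hb hab => ?_⟩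
  · rcases Finset.mem_insert.1 hp with rfl | hp
    exacts [hk, h3 p hp]
  · refine ⟨(h4 a ha b hb hab).1, fun hc => ?_⟩
    rcases eq_or_ne a k with rfl | hak
    · rcases Finset.mem_insert.1 hb with rfl | hb
      · omega
      · have := hP b hb; omega
    · exact (h4 a ha b hb hab).2 (hc.imp_left fun h' => Finset.mem_of_mem_insert_of_ne h' hak)

theorem stateA_succ_subset (s : ℕ) : stateA (s + 1) ⊆ stateA s := by
  rintro l ⟨h, h1, h2⟩
  refine ⟨h, fun p hp => le_trans ?_ (h1 p hp), fun p hp => le_trans ?_ (h2 p hp)⟩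
  · unfold minPart; omega
  · unfold minOver; omega

theorem add_four_le_of_mem_stateA_jump {s : ℕ} {l : Finset ℕ × Finset ℕ}
    (hl : l ∈ stateA (jump s)) :
    (∀ p ∈ l.1, minPart s + 4 ≤ p) ∧ (∀ p ∈ l.2, minPart s + 5 ≤ p) ∧
      ∀ p ∈ l.1, p ∈ l.2 ∨ 4 ∣ p → minPart s + 5 ≤ p := by
  obtain ⟨-, h1, h2⟩ := hl
  have h3 : ∀ p ∈ l.1, minPart s + 4 ≤ p := fun p hp => by
    have := h1 p hp
    unfold jump minPart at *; split_ifs at * <;> omega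
  have h4 : ∀ p ∈ l.2, minPart s + 5 ≤ p := fun p hp => by
    have := h2 p hp
    unfold jump minOver minPart at *; split_ifs at * <;> omega
  refine ⟨h3, h4, fun p hp hc => ?_⟩
  rcases hc with hc | hc
  · exact h4 p hc
  · have := h1 p hp
    unfold jump minPart at *; split_ifs at * <;> omega

theorem odd_minPart {s : ℕ} (hs : s % 3 = 0) : Odd (minPart s) := by
  rw [Nat.odd_iff]; unfold minPart; omega

theorem minPart_notMem {s : ℕ} {l : Finset ℕ × Finset ℕ} (hl : l ∈ stateA (jump s)) :
    minPart s ∉ l.1 ∧ minPart s ∉ l.2 := by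
  obtain ⟨h1, h2, -⟩ := add_four_le_of_mem_stateA_jump hl
  exact ⟨fun h => by have := h1 _ h; omega, fun h => by have := h2 _ h; omega⟩

theorem addPart_mem {s : ℕ} {l : Finset ℕ × Finset ℕ} (hl : l ∈ stateA (jump s)) :
    addPart s l ∈ stateA s \ stateA (s + 1) := by
  obtain ⟨h1, h2, h3⟩ := add_four_le_of_mem_stateA_jump hl
  have hover : ∀ p ∈ l.2, minOver s ≤ p := fun p hp => by
    have := h2 p hp
    unfold minPart minOver at *; omega
  have hpart : ∀ p ∈ insert (minPart s) l.1, minPart s ≤ p := fun p hp => by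
    rcases Finset.mem_insert.1 hp with rfl | hp
    · exact le_rfl
    · have := h1 p hp; omega
  unfold addPart
  by_cases hs : s % 3 = 0
  · simp only [hs, if_true]
    refine ⟨⟨memA_insert_overlined hl.1 (odd_minPart hs) h1 h3, hpart, fun p hp => ?_⟩, fun h => ?_⟩
    · rcases Finset.mem_insert.1 hp with rfl | hp
      · unfold minPart minOver; omega
      · exact hover p hp
    · have := h.2.2 (minPart s) (Finset.mem_insert_self _ _)
      unfold minPart minOver at *; omega
  · simp only [hs, if_false]
    refine ⟨⟨memA_insert hl.1 (by unfold minPart; omega) h1 h3, hpart, hover⟩, fun h => ?_⟩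
    have := h.2.1 (minPart s) (Finset.mem_insert_self _ _)
    unfold minPart at this
    obtain hs' | hs' : s % 3 = 1 ∨ s % 3 = 2 := by omega
    all_goals omega

theorem exists_addPart_eq {s : ℕ} {l : Finset ℕ × Finset ℕ}
    (hl : l ∈ stateA s \ stateA (s + 1)) : ∃ m ∈ stateA (jump s), addPart s m = l := by
  obtain ⟨⟨h, h1, h2⟩, h3⟩ := hl
  obtain ⟨P, O⟩ := l
  dsimp only at *
  have hk : minPart s ∈ P ∧ (s % 3 = 0 ↔ minPart s ∈ O) := by
    by_cases hs : s % 3 = 0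
    · by_cases hO : minPart s ∈ O
      · exact ⟨h.2.1 hO, by simp [hs, hO]⟩
      · refine absurd ⟨h, fun p hp => ?_, fun p hp => ?_⟩ h3
        · have := h1 p hp
          unfold minPart at *; omega
        · have := h2 p hp
          have hodd := Nat.odd_iff.1 (h.2.2.1 p hp)
          have hne : p ≠ minPart s := fun e => hO (e ▸ hp)
          unfold minPart minOver at *; omega
    · have hO : minPart s ∉ O := fun hO => by
        have := h2 _ hO
        have hodd := Nat.odd_iff.1 (h.2.2.1 _ hO)
        unfold minPart minOver at *; omega
      refine ⟨by_contra fun hP => h3 ⟨h, fun p hp => ?_, fun p hp => ?_⟩, by simp [hs, hO]⟩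
      · have := h1 p hp
        have hne : p ≠ minPart s := fun e => hP (e ▸ hp)
        unfold minPart at *; omega
      · have := h1 p (h.2.1 hp)
        have := h2 p hp
        have hne : p ≠ minPart s := fun e => hO (e ▸ hp)
        have hodd := Nat.odd_iff.1 (h.2.2.1 p hp)
        unfold minPart minOver at *; omega
  obtain ⟨hkP, hkO⟩ := hk
  refine ⟨(P.erase (minPart s), O.erase (minPart s)),
    ⟨h.subset (Finset.erase_subset _ _) (Finset.erase_subset _ _)
      (Finset.erase_subset_erase _ h.2.1), fun p hp => ?_, fun p hp => ?_⟩, ?_⟩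
  · obtain ⟨hne, hp⟩ := Finset.mem_erase.1 hp
    have hle := h1 p hp
    obtain ⟨h4, h5⟩ := h.2.2.2 p hp _ hkP (by omega)
    have h6 : 4 ∣ p → _ := fun hd => h5 (Or.inr hd)
    unfold jump minPart at *; split_ifs <;> omega
  · obtain ⟨hne, hp⟩ := Finset.mem_erase.1 hp
    have hle := h1 p (h.2.1 hp)
    obtain ⟨h4, h5⟩ := h.2.2.2 p (h.2.1 hp) _ hkP (by omega)
    have h6 := h5 (Or.inl hp)
    have hodd := Nat.odd_iff.1 (h.2.2.1 p hp)
    unfold jump minPart minOver at *; split_ifs <;> omega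
  · unfold addPart
    refine Prod.ext (Finset.insert_erase hkP) ?_
    by_cases hs : s % 3 = 0
    · simpa [hs] using Finset.insert_erase (hkO.1 hs)
    · simpa [hs] using fun hO => hs (hkO.2 hO)

theorem bijOn_addPart (s : ℕ) :
    BijOn (addPart s) (stateA (jump s)) (stateA s \ stateA (s + 1)) := by
  refine ⟨fun l hl => addPart_mem hl, fun l hl m hm hlm => ?_, fun l hl => exists_addPart_eq hl⟩
  obtain ⟨hl1, hl2⟩ := minPart_notMem hl
  obtain ⟨hm1, hm2⟩ := minPart_notMem hm
  unfold addPart at hlm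
  rw [Prod.mk.injEq] at hlm
  refine Prod.ext ?_ ?_
  · rw [← Finset.erase_insert hl1, hlm.1, Finset.erase_insert hm1]
  · by_cases hs : s % 3 = 0
    · have := hlm.2
      simp only [hs, if_true] at this
      rw [← Finset.erase_insert hl2, this, Finset.erase_insert hm2]
    · simpa [hs] using hlm.2

/-- The weight of an overpartition. -/
noncomputable def weight (q x y₁ y₂ z : ℂ) (l : Finset ℕ × Finset ℕ) : ℂ :=
  x ^ l.1.card * y₁ ^ countMod 2 4 l.1 * y₂ ^ countMod 0 4 l.1 * z ^ l.2.card * q ^ l.1.sum id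

/-- The factor by which `addPart s` multiplies the weight. -/
noncomputable def partWeight (q x y₁ y₂ z : ℂ) (s : ℕ) : ℂ :=
  x * (if s % 3 = 0 then z else if s % 6 = 2 then y₁ else if s % 6 = 5 then y₂ else 1) *
    q ^ minPart s

theorem countMod_insert {a M k : ℕ} {P : Finset ℕ} (hk : k ∉ P) :
    countMod a M (insert k P) = countMod a M P + if k % M = a then 1 else 0 := by
  unfold countMod
  rw [Finset.filter_insert]
  split_ifs
  · exact Finset.card_insert_of_notMem fun h => hk (Finset.mem_of_mem_filter _ h)
  · rfl

theorem weight_addPart (q x y₁ y₂ z : ℂ) {s : ℕ} {l : Finset ℕ × Finset ℕ}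
    (hl : l ∈ stateA (jump s)) :
    weight q x y₁ y₂ z (addPart s l) = partWeight q x y₁ y₂ z s * weight q x y₁ y₂ z l := by
  obtain ⟨hl1, hl2⟩ := minPart_notMem hl
  unfold weight partWeight addPart
  dsimp only
  rw [countMod_insert hl1, countMod_insert hl1, Finset.sum_insert hl1,
    Finset.card_insert_of_notMem hl1]
  have h2 : minPart s % 4 = 2 ↔ s % 6 = 2 := by unfold minPart; omega
  have h0 : minPart s % 4 = 0 ↔ s % 6 = 5 := by unfold minPart; omega
  simp only [h2, h0, id]
  by_cases hs : s % 3 = 0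
  · simp only [hs, if_true, Finset.card_insert_of_notMem hl2, show s % 6 ≠ 2 by omega,
      show s % 6 ≠ 5 by omega, if_false]
    ring
  · simp only [hs, if_false]
    by_cases hs2 : s % 6 = 2
    · simp only [hs2, if_true, show ¬ (2 : ℕ) = 5 by omega, if_false]
      ring
    · simp only [hs2, if_false]
      split_ifs <;> ring

theorem norm_partWeight_le {q x y₁ y₂ z : ℂ} (hx : ‖x‖ ≤ 1) (hy₁ : ‖y₁‖ ≤ 1)
    (hy₂ : ‖y₂‖ ≤ 1) (hz : ‖z‖ ≤ 1) (s : ℕ) :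
    ‖partWeight q x y₁ y₂ z s‖ ≤ ‖q‖ ^ minPart s := by
  unfold partWeight
  rw [norm_mul, norm_mul, norm_pow]
  refine mul_le_of_le_one_left (by positivity) (mul_le_one₀ hx (norm_nonneg _) ?_)
  split_ifs <;> simp [*]

theorem norm_weight_le {q x y₁ y₂ z : ℂ} (hx : ‖x‖ ≤ 1) (hy₁ : ‖y₁‖ ≤ 1)
    (hy₂ : ‖y₂‖ ≤ 1) (hz : ‖z‖ ≤ 1) (l : Finset ℕ × Finset ℕ) :
    ‖weight q x y₁ y₂ z l‖ ≤ ‖q‖ ^ l.1.sum id := by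
  unfold weight
  simp only [norm_mul, norm_pow]
  refine mul_le_of_le_one_left (by positivity) ?_
  exact mul_le_one₀ (mul_le_one₀ (mul_le_one₀ (pow_le_one₀ (norm_nonneg _) hx) (by positivity)
    (pow_le_one₀ (norm_nonneg _) hy₁)) (by positivity) (pow_le_one₀ (norm_nonneg _) hy₂))
    (by positivity) (pow_le_one₀ (norm_nonneg _) hz)

theorem summable_indicator_pow_sum {r : ℝ} (h0 : 0 ≤ r) (h1 : r < 1) :
    Summable ({l | l.2 ⊆ l.1}.indicator fun l : Finset ℕ × Finset ℕ => r ^ l.1.sum id) := by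
  have hF : Summable fun s : Finset ℕ => r ^ s.sum id := by
    refine (summable_finsetProd_of_summable_nonneg (fun i => pow_nonneg h0 i)
      (summable_geometric_of_lt_one h0 h1)).congr fun s => ?_
    exact Finset.prod_pow_eq_pow_sum s id r
  have hFF := hF.mul_of_nonneg hF (fun _ => by positivity) fun _ => by positivity
  rw [← summable_subtype_iff_indicator]
  refine (hFF.comp_injective (i := fun l : {l : Finset ℕ × Finset ℕ | l.2 ⊆ l.1} =>
    (l.1.1 \ l.1.2, l.1.2)) fun l m hlm => ?_).congr fun l => ?_
  · rw [Prod.mk.injEq] at hlm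
    refine Subtype.ext (Prod.ext ?_ hlm.2)
    rw [← Finset.sdiff_union_of_subset l.2, ← Finset.sdiff_union_of_subset m.2, hlm.1, hlm.2]
  · simp only [Function.comp_apply, ← pow_add, Finset.sum_sdiff l.2]

theorem norm_indicator_weight_le {q x y₁ y₂ z : ℂ} (hx : ‖x‖ ≤ 1) (hy₁ : ‖y₁‖ ≤ 1)
    (hy₂ : ‖y₂‖ ≤ 1) (hz : ‖z‖ ≤ 1) (s : ℕ) (l : Finset ℕ × Finset ℕ) :
    ‖(stateA s).indicator (weight q x y₁ y₂ z) l‖ ≤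
      {l | l.2 ⊆ l.1}.indicator (fun l : Finset ℕ × Finset ℕ => ‖q‖ ^ l.1.sum id) l := by
  by_cases hl : l ∈ stateA s
  · rw [indicator_of_mem hl, indicator_of_mem (show l ∈ {l | l.2 ⊆ l.1} from hl.1.2.1)]
    exact norm_weight_le hx hy₁ hy₂ hz l
  · rw [indicator_of_notMem hl, norm_zero]
    exact indicator_nonneg (fun _ _ => by positivity) _

theorem summable_indicator_weight {q x y₁ y₂ z : ℂ} (hq : ‖q‖ < 1) (hx : ‖x‖ ≤ 1)
    (hy₁ : ‖y₁‖ ≤ 1) (hy₂ : ‖y₂‖ ≤ 1) (hz : ‖z‖ ≤ 1) (s : ℕ) :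
    Summable ((stateA s).indicator (weight q x y₁ y₂ z)) :=
  (summable_indicator_pow_sum (norm_nonneg q) hq).of_norm_bounded
    (norm_indicator_weight_le hx hy₁ hy₂ hz s)

theorem tsum_indicator_weight_recurrence {q x y₁ y₂ z : ℂ} (hq : ‖q‖ < 1) (hx : ‖x‖ ≤ 1)
    (hy₁ : ‖y₁‖ ≤ 1) (hy₂ : ‖y₂‖ ≤ 1) (hz : ‖z‖ ≤ 1) (s : ℕ) :
    ∑' l, (stateA s).indicator (weight q x y₁ y₂ z) l =
      ∑' l, (stateA (s + 1)).indicator (weight q x y₁ y₂ z) l +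
        partWeight q x y₁ y₂ z s *
          ∑' l, (stateA (jump s)).indicator (weight q x y₁ y₂ z) l := by
  have hbij := bijOn_addPart s
  refine tsum_eq_tsum_add_mul_tsum (summable_indicator_weight hq hx hy₁ hy₂ hz s)
    (summable_indicator_weight hq hx hy₁ hy₂ hz (s + 1)) hbij.injOn
    support_indicator_subset (fun l hl => ?_) fun l hl => ?_
  · rw [hbij.image_eq] at hl
    by_cases hl' : l ∈ stateA (s + 1)
    · rw [indicator_of_mem hl', indicator_of_mem (stateA_succ_subset s hl')]
    · rw [indicator_of_notMem hl', indicator_of_notMem fun h => hl ⟨h, hl'⟩]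
  · obtain ⟨h1, h2⟩ := addPart_mem hl
    rw [indicator_of_mem h1, indicator_of_notMem h2, indicator_of_mem hl, zero_add,
      weight_addPart q x y₁ y₂ z hl]

theorem tendsto_tsum_indicator_weight {q x y₁ y₂ z : ℂ} (hq : ‖q‖ < 1) (hx : ‖x‖ ≤ 1)
    (hy₁ : ‖y₁‖ ≤ 1) (hy₂ : ‖y₂‖ ≤ 1) (hz : ‖z‖ ≤ 1) :
    Tendsto (fun s => ∑' l, (stateA s).indicator (weight q x y₁ y₂ z) l) atTop (𝓝 1) := by
  have key := tendsto_tsum_of_dominated_convergence (𝓕 := atTop)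
    (g := fun l : Finset ℕ × Finset ℕ => if l = (∅, ∅) then (1 : ℂ) else 0)
    (summable_indicator_pow_sum (norm_nonneg q) hq) (fun l => ?_)
    (Eventually.of_forall (norm_indicator_weight_le (q := q) hx hy₁ hy₂ hz))
  · simpa using key
  · refine tendsto_const_nhds.congr' ?_
    obtain ⟨P, O⟩ := l
    rcases P.eq_empty_or_nonempty with rfl | ⟨p, hp⟩
    · refine Eventually.of_forall fun s => ?_
      beta_reduce
      rcases O.eq_empty_or_nonempty with rfl | ⟨p, hp⟩
      · rw [indicator_of_mem (by simp [stateA, MemA])]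
        simp [weight, countMod]
      · rw [indicator_of_notMem fun h => by simpa using h.1.2.1 hp, if_neg]
        intro h
        simp [(Prod.mk.inj h).2] at hp
    · filter_upwards [eventually_ge_atTop (2 * p)] with s hs
      rw [indicator_of_notMem fun h => ?_, if_neg]
      · intro h
        simp [(Prod.mk.inj h).1] at hp
      · have := h.2.1 p hp
        unfold minPart at this; omega

/-- Lower bound for the odd parts without overline after `s` steps of the recurrence. -/
def minPlain (s : ℕ) : ℕ := 1 + 2 * ((s + 1) / 3)

/-- Lower bound for the parts that are `2` modulo `4` after `s` steps of the recurrence. -/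
def minTwoModFour (s : ℕ) : ℕ := 2 + 4 * ((s + 3) / 6)

/-- Lower bound for the parts divisible by `4` after `s` steps of the recurrence. -/
def minFourDvd (s : ℕ) : ℕ := 4 + 4 * (s / 6)

/-- The linear part of the exponent of `q` in the series for `stateA s`. -/
def linearExp (s : ℕ) (n : ℕ × ℕ × ℕ × ℕ) : ℕ :=
  minPlain s * n.1 + minOver s * n.2.1 + minTwoModFour s * n.2.2.1 + minFourDvd s * n.2.2.2

/-- The denominators of the multiple series. -/
noncomputable def pochDenom (q : ℂ) (n : ℕ × ℕ × ℕ × ℕ) : ℂ :=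
  qPoch (q ^ 2) (q ^ 2) n.1 * qPoch (q ^ 2) (q ^ 2) n.2.1 *
    qPoch (q ^ 4) (q ^ 4) n.2.2.1 * qPoch (q ^ 4) (q ^ 4) n.2.2.2

/-- Raises by one the coordinate that counts the parts added by `addPart s`. -/
def raise (s : ℕ) (n : ℕ × ℕ × ℕ × ℕ) : ℕ × ℕ × ℕ × ℕ :=
  if s % 3 = 0 then (n.1, n.2.1 + 1, n.2.2.1, n.2.2.2)
  else if s % 3 = 1 then (n.1 + 1, n.2.1, n.2.2.1, n.2.2.2)
  else if s % 6 = 2 then (n.1, n.2.1, n.2.2.1 + 1, n.2.2.2)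
  else (n.1, n.2.1, n.2.2.1, n.2.2.2 + 1)

theorem raise_injective (s : ℕ) : Function.Injective (raise s) := by
  rintro ⟨a, b, c, d⟩ ⟨a', b', c', d'⟩ h
  unfold raise at h
  split_ifs at h <;> simpa using h

theorem norm_pow_lt_one {q : ℂ} (hq : ‖q‖ < 1) {k : ℕ} (hk : k ≠ 0) : ‖q ^ k‖ < 1 := by
  rw [norm_pow]
  exact pow_lt_one₀ (norm_nonneg q) hq hk

theorem choose_succ_two (n : ℕ) : (n + 1).choose 2 = n.choose 2 + n := by
  rw [Nat.choose_succ_succ' n 1, Nat.choose_one_right, add_comm]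

theorem exists_pochDenom_raise (q : ℂ) (s : ℕ) (n : ℕ × ℕ × ℕ × ℕ) :
    ∃ e, e ≠ 0 ∧ pochDenom q (raise s n) = pochDenom q n * (1 - q ^ e) ∧
      linearExp (s + 1) (raise s n) = linearExp s (raise s n) + e := by
  obtain ⟨a, b, c, d⟩ := n
  unfold pochDenom linearExp raise
  split_ifs with h1 h2 h3
  · refine ⟨2 * (b + 1), by omega, ?_, ?_⟩
    · simp only [qPoch_succ]; ring
    · rw [show minPlain (s + 1) = minPlain s by unfold minPlain; omega,
        show minOver (s + 1) = minOver s + 2 by unfold minOver; omega,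
        show minTwoModFour (s + 1) = minTwoModFour s by unfold minTwoModFour; omega,
        show minFourDvd (s + 1) = minFourDvd s by unfold minFourDvd; omega]
      ring
  · refine ⟨2 * (a + 1), by omega, ?_, ?_⟩
    · simp only [qPoch_succ]; ring
    · rw [show minPlain (s + 1) = minPlain s + 2 by unfold minPlain; omega,
        show minOver (s + 1) = minOver s by unfold minOver; omega,
        show minTwoModFour (s + 1) = minTwoModFour s by unfold minTwoModFour; omega,
        show minFourDvd (s + 1) = minFourDvd s by unfold minFourDvd; omega]
      ring
  · refine ⟨4 * (c + 1), by omega, ?_, ?_⟩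
    · simp only [qPoch_succ]; ring
    · rw [show minPlain (s + 1) = minPlain s by unfold minPlain; omega,
        show minOver (s + 1) = minOver s by unfold minOver; omega,
        show minTwoModFour (s + 1) = minTwoModFour s + 4 by unfold minTwoModFour; omega,
        show minFourDvd (s + 1) = minFourDvd s by unfold minFourDvd; omega]
      ring
  · refine ⟨4 * (d + 1), by omega, ?_, ?_⟩
    · simp only [qPoch_succ]; ring
    · rw [show minPlain (s + 1) = minPlain s by unfold minPlain; omega,
        show minOver (s + 1) = minOver s by unfold minOver; omega,
        show minTwoModFour (s + 1) = minTwoModFour s by unfold minTwoModFour; omega,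
        show minFourDvd (s + 1) = minFourDvd s + 4 by unfold minFourDvd; omega]
      ring

/-- The total exponent of `q` in the numerators of the series for `stateA s`. -/
def totalExp (s : ℕ) (n : ℕ × ℕ × ℕ × ℕ) : ℕ :=
  Qform n.1 n.2.1 n.2.2.1 n.2.2.2 + linearExp s n

theorem totalExp_raise (s : ℕ) (n : ℕ × ℕ × ℕ × ℕ) :
    totalExp s (raise s n) = totalExp (jump s) n + minPart s := by
  obtain ⟨a, b, c, d⟩ := n
  unfold totalExp linearExp raise Qform jump
  by_cases h0 : s % 3 = 0
  · simp only [h0, if_true, show ¬ ((0 : ℕ) = 1 ∨ s % 6 = 2) by omega, if_false, choose_succ_two]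
    rw [show minPlain (s + 7) = minPlain s + 4 by unfold minPlain; omega,
      show minOver (s + 7) = minOver s + 6 by unfold minOver; omega,
      show minTwoModFour (s + 7) = minTwoModFour s + 4 by unfold minTwoModFour; omega,
      show minFourDvd (s + 7) = minFourDvd s + 4 by unfold minFourDvd; omega,
      show minPart s = minOver s by unfold minPart minOver; omega]
    ring
  by_cases h1 : s % 3 = 1
  · simp only [h1, if_true, show ¬ (1 : ℕ) = 0 by omega, true_or, if_false, choose_succ_two]
    rw [show minPlain (s + 6) = minPlain s + 4 by unfold minPlain; omega,
      show minOver (s + 6) = minOver s + 4 by unfold minOver; omega,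
      show minTwoModFour (s + 6) = minTwoModFour s + 4 by unfold minTwoModFour; omega,
      show minFourDvd (s + 6) = minFourDvd s + 4 by unfold minFourDvd; omega,
      show minPart s = minPlain s by unfold minPart minPlain; omega]
    ring
  by_cases h2 : s % 6 = 2
  · simp only [h2, h0, h1, if_true, or_true, if_false, choose_succ_two]
    rw [show minPlain (s + 6) = minPlain s + 4 by unfold minPlain; omega,
      show minOver (s + 6) = minOver s + 4 by unfold minOver; omega,
      show minTwoModFour (s + 6) = minTwoModFour s + 4 by unfold minTwoModFour; omega,
      show minFourDvd (s + 6) = minFourDvd s + 4 by unfold minFourDvd; omega,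
      show minPart s = minTwoModFour s by unfold minPart minTwoModFour; omega]
    ring
  · simp only [h2, h0, h1, or_false, if_false, choose_succ_two]
    rw [show minPlain (s + 7) = minPlain s + 4 by unfold minPlain; omega,
      show minOver (s + 7) = minOver s + 4 by unfold minOver; omega,
      show minTwoModFour (s + 7) = minTwoModFour s + 4 by unfold minTwoModFour; omega,
      show minFourDvd (s + 7) = minFourDvd s + 8 by unfold minFourDvd; omega,
      show minPart s = minFourDvd s by unfold minPart minFourDvd; omega]
    ring

/-- The monomial of the variables other than `q` in the numerators of the series. -/
def monomialA (x y₁ y₂ z : ℂ) (n : ℕ × ℕ × ℕ × ℕ) : ℂ :=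
  x ^ (n.1 + n.2.1 + n.2.2.1 + n.2.2.2) * y₁ ^ n.2.2.1 * y₂ ^ n.2.2.2 * z ^ n.2.1

theorem monomialA_raise (q x y₁ y₂ z : ℂ) (s : ℕ) (n : ℕ × ℕ × ℕ × ℕ) :
    monomialA x y₁ y₂ z (raise s n) * q ^ minPart s =
      partWeight q x y₁ y₂ z s * monomialA x y₁ y₂ z n := by
  obtain ⟨a, b, c, d⟩ := n
  unfold monomialA raise partWeight
  by_cases h0 : s % 3 = 0
  · simp only [h0, if_true]; ring
  by_cases h1 : s % 3 = 1
  · simp only [h1, show ¬ (1 : ℕ) = 0 by omega, show ¬ s % 6 = 2 by omega,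
      show ¬ s % 6 = 5 by omega, if_true, if_false]
    ring
  by_cases h2 : s % 6 = 2
  · simp only [h2, h0, h1, if_true, if_false]; ring
  · simp only [h0, h1, show s % 6 = 5 by omega, show ¬ (5 : ℕ) = 2 by omega, if_true, if_false]
    ring

/-- The general term of the multiple series for `stateA s`. -/
noncomputable def seriesTerm (q x y₁ y₂ z : ℂ) (s : ℕ) (n : ℕ × ℕ × ℕ × ℕ) : ℂ :=
  monomialA x y₁ y₂ z n * q ^ totalExp s n / pochDenom q n

theorem seriesTerm_raise {q : ℂ} (hq : ‖q‖ < 1) (x y₁ y₂ z : ℂ) (s : ℕ)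
    (n : ℕ × ℕ × ℕ × ℕ) :
    seriesTerm q x y₁ y₂ z s (raise s n) = seriesTerm q x y₁ y₂ z (s + 1) (raise s n) +
      partWeight q x y₁ y₂ z s * seriesTerm q x y₁ y₂ z (jump s) n := by
  obtain ⟨e, he, hden, hlin⟩ := exists_pochDenom_raise q s n
  have hexp : totalExp (s + 1) (raise s n) = totalExp s (raise s n) + e := by
    rw [totalExp, hlin, ← add_assoc, totalExp]
  have hne : 1 - q ^ e ≠ 0 := sub_ne_zero.2 fun h => by
    simpa [← h] using norm_pow_lt_one hq he
  have hmon := monomialA_raise q x y₁ y₂ z s n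
  unfold seriesTerm
  rw [hexp, hden, totalExp_raise, ← sub_eq_iff_eq_add', ← sub_div, pow_add _ _ e, ← mul_assoc,
    ← mul_one_sub, mul_div_mul_right _ _ hne, ← mul_div_assoc, ← mul_assoc, ← hmon, pow_add]
  ring

theorem linearExp_ge (s : ℕ) (n : ℕ × ℕ × ℕ × ℕ) :
    n.1 + n.2.1 + n.2.2.1 + n.2.2.2 ≤ linearExp s n := by
  unfold linearExp minPlain minOver minTwoModFour minFourDvd
  gcongr <;> exact Nat.le_mul_of_pos_left _ (by omega)

theorem tendsto_linearExp {n : ℕ × ℕ × ℕ × ℕ} (hn : n ≠ 0) :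
    Tendsto (fun s => linearExp s n) atTop atTop := by
  refine tendsto_atTop_mono (f := fun s => s / 6) (fun s => ?_)
    (Nat.tendsto_div_const_atTop (by norm_num))
  have h : 1 ≤ n.1 + n.2.1 + n.2.2.1 + n.2.2.2 := by
    by_contra h
    exact hn (by ext <;> simp <;> omega)
  calc s / 6 ≤ s / 6 * (n.1 + n.2.1 + n.2.2.1 + n.2.2.2) := Nat.le_mul_of_pos_right _ h
    _ = s / 6 * n.1 + s / 6 * n.2.1 + s / 6 * n.2.2.1 + s / 6 * n.2.2.2 := by ring
    _ ≤ linearExp s n := by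
      unfold linearExp minPlain minOver minTwoModFour minFourDvd; gcongr <;> omega

theorem exists_norm_seriesTerm_le {q x y₁ y₂ z : ℂ} (hq : ‖q‖ < 1) (hx : ‖x‖ ≤ 1)
    (hy₁ : ‖y₁‖ ≤ 1) (hy₂ : ‖y₂‖ ≤ 1) (hz : ‖z‖ ≤ 1) :
    ∃ C, 0 ≤ C ∧ ∀ s n, ‖seriesTerm q x y₁ y₂ z s n‖ ≤ C * ‖q‖ ^ linearExp s n := by
  obtain ⟨A, hA0, hA⟩ := exists_norm_inv_qPoch_le (norm_pow_lt_one hq two_ne_zero)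
  obtain ⟨B, hB0, hB⟩ := exists_norm_inv_qPoch_le (norm_pow_lt_one hq four_ne_zero)
  refine ⟨A * A * B * B, by positivity, fun s n => ?_⟩
  have hden : ‖(pochDenom q n)⁻¹‖ ≤ A * A * B * B := by
    unfold pochDenom
    simp only [mul_inv, norm_mul]
    have h1 := hA n.1
    have h2 := hA n.2.1
    have h3 := hB n.2.2.1
    have h4 := hB n.2.2.2
    gcongr
  unfold seriesTerm
  rw [div_eq_mul_inv, norm_mul, mul_comm]
  refine mul_le_mul hden ?_ (norm_nonneg _) (by positivity)
  unfold monomialA totalExp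
  rw [pow_add q, ← mul_assoc]
  simp only [norm_mul, norm_pow]
  refine mul_le_of_le_one_left (by positivity) ?_
  exact mul_le_one₀ (mul_le_one₀ (mul_le_one₀ (mul_le_one₀ (pow_le_one₀ (norm_nonneg _) hx)
    (by positivity) (pow_le_one₀ (norm_nonneg _) hy₁)) (by positivity)
    (pow_le_one₀ (norm_nonneg _) hy₂)) (by positivity) (pow_le_one₀ (norm_nonneg _) hz))
    (by positivity) (pow_le_one₀ (norm_nonneg _) hq.le)

theorem summable_pow_add_four {r : ℝ} (h0 : 0 ≤ r) (h1 : r < 1) :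
    Summable fun n : ℕ × ℕ × ℕ × ℕ => r ^ (n.1 + n.2.1 + n.2.2.1 + n.2.2.2) := by
  have h := summable_geometric_of_lt_one h0 h1
  have hn : ∀ n : ℕ, 0 ≤ r ^ n := fun n => by positivity
  have h2 := h.mul_of_nonneg h hn hn
  have h3 := h.mul_of_nonneg h2 hn fun _ => mul_nonneg (hn _) (hn _)
  have h4 := h.mul_of_nonneg h3 hn fun _ => mul_nonneg (hn _) (mul_nonneg (hn _) (hn _))
  exact h4.congr fun n => by ring

theorem exists_summable_bound_seriesTerm {q x y₁ y₂ z : ℂ} (hq : ‖q‖ < 1) (hx : ‖x‖ ≤ 1)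
    (hy₁ : ‖y₁‖ ≤ 1) (hy₂ : ‖y₂‖ ≤ 1) (hz : ‖z‖ ≤ 1) :
    ∃ b : ℕ × ℕ × ℕ × ℕ → ℝ, Summable b ∧ ∀ s n, ‖seriesTerm q x y₁ y₂ z s n‖ ≤ b n := by
  obtain ⟨C, hC0, hC⟩ := exists_norm_seriesTerm_le hq hx hy₁ hy₂ hz
  refine ⟨_, (summable_pow_add_four (norm_nonneg q) hq).mul_left C, fun s n =>
    (hC s n).trans ?_⟩
  exact mul_le_mul_of_nonneg_left
    (pow_le_pow_of_le_one (norm_nonneg q) hq.le (linearExp_ge s n)) hC0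

theorem summable_seriesTerm {q x y₁ y₂ z : ℂ} (hq : ‖q‖ < 1) (hx : ‖x‖ ≤ 1)
    (hy₁ : ‖y₁‖ ≤ 1) (hy₂ : ‖y₂‖ ≤ 1) (hz : ‖z‖ ≤ 1) (s : ℕ) :
    Summable (seriesTerm q x y₁ y₂ z s) := by
  obtain ⟨b, hb, hb'⟩ := exists_summable_bound_seriesTerm hq hx hy₁ hy₂ hz
  exact hb.of_norm_bounded (hb' s)

theorem tendsto_tsum_seriesTerm {q x y₁ y₂ z : ℂ} (hq : ‖q‖ < 1) (hx : ‖x‖ ≤ 1)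
    (hy₁ : ‖y₁‖ ≤ 1) (hy₂ : ‖y₂‖ ≤ 1) (hz : ‖z‖ ≤ 1) :
    Tendsto (fun s => ∑' n, seriesTerm q x y₁ y₂ z s n) atTop (𝓝 1) := by
  obtain ⟨b, hb, hb'⟩ := exists_summable_bound_seriesTerm hq hx hy₁ hy₂ hz
  obtain ⟨C, hC0, hC⟩ := exists_norm_seriesTerm_le hq hx hy₁ hy₂ hz
  have key := tendsto_tsum_of_dominated_convergence (𝓕 := atTop)
    (g := fun n : ℕ × ℕ × ℕ × ℕ => if n = 0 then (1 : ℂ) else 0) hb (fun n => ?_)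
    (Eventually.of_forall hb')
  · simpa using key
  · by_cases hn : n = 0
    · subst hn
      simp [seriesTerm, monomialA, totalExp, pochDenom, qPoch, Qform, linearExp]
    · rw [if_neg hn]
      refine squeeze_zero_norm (hC · n) ?_
      simpa using ((tendsto_pow_atTop_nhds_zero_of_lt_one (norm_nonneg q) hq).comp
        (tendsto_linearExp hn)).const_mul C

theorem seriesTerm_succ_of_notMem_range {s : ℕ} {n : ℕ × ℕ × ℕ × ℕ}
    (hn : n ∉ range (raise s)) (q x y₁ y₂ z : ℂ) :
    seriesTerm q x y₁ y₂ z s n = seriesTerm q x y₁ y₂ z (s + 1) n := by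
  suffices h : linearExp s n = linearExp (s + 1) n by
    simp only [seriesTerm, totalExp, h]
  obtain ⟨a, b, c, d⟩ := n
  unfold raise at hn
  unfold linearExp
  by_cases h0 : s % 3 = 0
  · rcases b with _ | b
    · rw [show minPlain (s + 1) = minPlain s by unfold minPlain; omega,
        show minTwoModFour (s + 1) = minTwoModFour s by unfold minTwoModFour; omega,
        show minFourDvd (s + 1) = minFourDvd s by unfold minFourDvd; omega]
      simp
    · exact absurd ⟨(a, b, c, d), by simp [h0]⟩ hn
  by_cases h1 : s % 3 = 1
  · rcases a with _ | a
    · rw [show minOver (s + 1) = minOver s by unfold minOver; omega,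
        show minTwoModFour (s + 1) = minTwoModFour s by unfold minTwoModFour; omega,
        show minFourDvd (s + 1) = minFourDvd s by unfold minFourDvd; omega]
      simp
    · exact absurd ⟨(a, b, c, d), by simp [h1]⟩ hn
  rw [show minPlain (s + 1) = minPlain s by unfold minPlain; omega,
    show minOver (s + 1) = minOver s by unfold minOver; omega]
  by_cases h2 : s % 6 = 2
  · rcases c with _ | c
    · rw [show minFourDvd (s + 1) = minFourDvd s by unfold minFourDvd; omega]
      simp
    · exact absurd ⟨(a, b, c, d), by simp [h0, h1, h2]⟩ hn
  · rcases d with _ | d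
    · rw [show minTwoModFour (s + 1) = minTwoModFour s by unfold minTwoModFour; omega]
      simp
    · exact absurd ⟨(a, b, c, d), by simp [h0, h1, h2]⟩ hn

theorem tsum_seriesTerm_recurrence {q x y₁ y₂ z : ℂ} (hq : ‖q‖ < 1) (hx : ‖x‖ ≤ 1)
    (hy₁ : ‖y₁‖ ≤ 1) (hy₂ : ‖y₂‖ ≤ 1) (hz : ‖z‖ ≤ 1) (s : ℕ) :
    ∑' n, seriesTerm q x y₁ y₂ z s n = ∑' n, seriesTerm q x y₁ y₂ z (s + 1) n +
      partWeight q x y₁ y₂ z s * ∑' n, seriesTerm q x y₁ y₂ z (jump s) n :=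
  tsum_eq_tsum_add_mul_tsum (summable_seriesTerm hq hx hy₁ hy₂ hz s)
    (summable_seriesTerm hq hx hy₁ hy₂ hz (s + 1)) (raise_injective s).injOn
    (subset_univ _) (fun n hn => seriesTerm_succ_of_notMem_range (by rwa [image_univ] at hn) ..)
    fun n _ => seriesTerm_raise hq ..

theorem tsum_indicator_weight_eq_tsum_seriesTerm {q x y₁ y₂ z : ℂ} (hq : ‖q‖ < 1)
    (hx : ‖x‖ ≤ 1) (hy₁ : ‖y₁‖ ≤ 1) (hy₂ : ‖y₂‖ ≤ 1) (hz : ‖z‖ ≤ 1) (s : ℕ) :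
    ∑' l, (stateA s).indicator (weight q x y₁ y₂ z) l = ∑' n, seriesTerm q x y₁ y₂ z s n := by
  refine sub_eq_zero.1 (eq_zero_of_recurrence (c := partWeight q x y₁ y₂ z) (u := jump)
    (D := fun s => ∑' l, (stateA s).indicator (weight q x y₁ y₂ z) l -
      ∑' n, seriesTerm q x y₁ y₂ z s n) ?_ ?_ lt_jump (fun s => ?_) s)
  · simpa using (tendsto_tsum_indicator_weight hq hx hy₁ hy₂ hz).sub
      (tendsto_tsum_seriesTerm hq hx hy₁ hy₂ hz)
  · exact (summable_pow_two_thirds (norm_nonneg q) hq).of_nonneg_of_le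
      (fun _ => norm_nonneg _) (norm_partWeight_le hx hy₁ hy₂ hz)
  · rw [tsum_indicator_weight_recurrence hq hx hy₁ hy₂ hz s,
      tsum_seriesTerm_recurrence hq hx hy₁ hy₂ hz s]
    ring

theorem stateA_zero : stateA 0 = {l | MemA l.1 l.2} := by
  ext l
  simp only [stateA, minPart, minOver, mem_ofPred_eq]
  exact ⟨fun h => h.1, fun h => ⟨h, h.1, fun p hp => h.1 p (h.2.1 hp)⟩⟩

end

/-- The quinvariate generating function for `𝒜` (first identity of Theorem 5.1). -/
theorem genfun_A (q x y₁ y₂ z : ℂ) (hq : ‖q‖ < 1)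
    (hx : ‖x‖ ≤ 1) (hy₁ : ‖y₁‖ ≤ 1) (hy₂ : ‖y₂‖ ≤ 1) (hz : ‖z‖ ≤ 1) :
    Summable (fun lam : {p : Finset ℕ × Finset ℕ // MemA p.1 p.2} =>
      x ^ lam.1.1.card * y₁ ^ countMod 2 4 lam.1.1 * y₂ ^ countMod 0 4 lam.1.1 *
        z ^ lam.1.2.card * q ^ lam.1.1.sum id) ∧
    Summable (fun n : ℕ × ℕ × ℕ × ℕ =>
      x ^ (n.1 + n.2.1 + n.2.2.1 + n.2.2.2) * y₁ ^ n.2.2.1 * y₂ ^ n.2.2.2 * z ^ n.2.1 *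
        q ^ (Qform n.1 n.2.1 n.2.2.1 n.2.2.2 + n.1 + n.2.1 + 2 * n.2.2.1 + 4 * n.2.2.2) /
        (qPoch (q ^ 2) (q ^ 2) n.1 * qPoch (q ^ 2) (q ^ 2) n.2.1 *
          qPoch (q ^ 4) (q ^ 4) n.2.2.1 * qPoch (q ^ 4) (q ^ 4) n.2.2.2)) ∧
    ∑' lam : {p : Finset ℕ × Finset ℕ // MemA p.1 p.2},
        x ^ lam.1.1.card * y₁ ^ countMod 2 4 lam.1.1 * y₂ ^ countMod 0 4 lam.1.1 *
          z ^ lam.1.2.card * q ^ lam.1.1.sum id =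
      ∑' n : ℕ × ℕ × ℕ × ℕ,
        x ^ (n.1 + n.2.1 + n.2.2.1 + n.2.2.2) * y₁ ^ n.2.2.1 * y₂ ^ n.2.2.2 * z ^ n.2.1 *
          q ^ (Qform n.1 n.2.1 n.2.2.1 n.2.2.2 + n.1 + n.2.1 + 2 * n.2.2.1 + 4 * n.2.2.2) /
          (qPoch (q ^ 2) (q ^ 2) n.1 * qPoch (q ^ 2) (q ^ 2) n.2.1 *
            qPoch (q ^ 4) (q ^ 4) n.2.2.1 * qPoch (q ^ 4) (q ^ 4) n.2.2.2) := by
  have hlhs := summable_indicator_weight hq hx hy₁ hy₂ hz 0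
  have hrhs := summable_seriesTerm hq hx hy₁ hy₂ hz 0
  have heq := tsum_indicator_weight_eq_tsum_seriesTerm hq hx hy₁ hy₂ hz 0
  have hterm : seriesTerm q x y₁ y₂ z 0 = fun n : ℕ × ℕ × ℕ × ℕ =>
      x ^ (n.1 + n.2.1 + n.2.2.1 + n.2.2.2) * y₁ ^ n.2.2.1 * y₂ ^ n.2.2.2 * z ^ n.2.1 *
        q ^ (Qform n.1 n.2.1 n.2.2.1 n.2.2.2 + n.1 + n.2.1 + 2 * n.2.2.1 + 4 * n.2.2.2) /
        (qPoch (q ^ 2) (q ^ 2) n.1 * qPoch (q ^ 2) (q ^ 2) n.2.1 *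
          qPoch (q ^ 4) (q ^ 4) n.2.2.1 * qPoch (q ^ 4) (q ^ 4) n.2.2.2) := by
    funext n
    simp [seriesTerm, monomialA, totalExp, pochDenom, linearExp, minPlain, minOver,
      minTwoModFour, minFourDvd, add_assoc]
  rw [stateA_zero] at hlhs heq
  rw [hterm] at hrhs heq
  rw [← tsum_subtype] at heq
  exact ⟨summable_subtype_iff_indicator.2 hlhs, hrhs, heq⟩
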